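/- (Hilbert's syzygy theorem for a quotient of a PID.) Let R be a principal ideal domain, N ∈ R nonzero and not a unit, R̄ = R/NR, S = R̄[x_1,…,x_n], and M a finitely generated S-module. Then there exist p ≤ n+1 and finitely generated free S-modules F_0,…,F_p together with an exact sequence ⋯ → F_p → F_p → F_p → F_{p−1} → ⋯ → F_1 → F_0 → M → 0; that is, an infinite free resolution (G_i)_{i≥0} of M by finitely generated free S-modules with G_i = F_i for 0 ≤ i ≤ p and G_i = F_p for all i ≥ p. -/

import Mathlib

open MvPolynomial
open scoped MonomialOrder

namespace PaperGB

variable {n : ℕ} {R : Type*} [CommSemiring R]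

/-- The degree (leading exponent) of a multivariate polynomial w.r.t. a monomial order. -/
noncomputable def mDeg (m : MonomialOrder (Fin n)) (f : MvPolynomial (Fin n) R) :
    Fin n →₀ ℕ :=
  m.toSyn.symm (f.support.sup fun d => m.toSyn d)

/-- The leading coefficient. -/
noncomputable def mLC (m : MonomialOrder (Fin n)) (f : MvPolynomial (Fin n) R) : R :=
  f.coeff (mDeg m f)

/-- The leading term. -/
noncomputable def mLT (m : MonomialOrder (Fin n)) (f : MvPolynomial (Fin n) R) :
    MvPolynomial (Fin n) R :=
  monomial (mDeg m f) (mLC m f)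

variable {R : Type*} [CommRing R]

/-- The leading term ideal. -/
noncomputable def mLTIdeal (m : MonomialOrder (Fin n)) (I : Ideal (MvPolynomial (Fin n) R)) :
    Ideal (MvPolynomial (Fin n) R) :=
  Ideal.span ((fun g => mLT m g) '' {g | g ∈ I ∧ g ≠ 0})

/-- `f` is a Gröbner basis of `I`. -/
def IsGroebnerBasis (m : MonomialOrder (Fin n)) (I : Ideal (MvPolynomial (Fin n) R))
    {k : ℕ} (f : Fin k → MvPolynomial (Fin n) R) : Prop :=
  (∀ i, f i ≠ 0) ∧ (∀ i, f i ∈ I) ∧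
    Ideal.span (Set.range fun i => mLT m (f i)) = mLTIdeal m I

/-- `g` reduces to zero modulo the family `f`. -/
def ReducesToZero (m : MonomialOrder (Fin n)) {k : ℕ} (f : Fin k → MvPolynomial (Fin n) R)
    (g : MvPolynomial (Fin n) R) : Prop :=
  ∃ p : Fin k → MvPolynomial (Fin n) R,
    g = ∑ i, p i * f i ∧
    ∀ i, p i * f i ≠ 0 → mDeg m (p i) + mDeg m (f i) ≼[m] mDeg m g

/-- A weakly regular sequence. -/
def IsWeakRegularSeq {k : ℕ} (s : Fin k → R) : Prop :=
  ∀ i : Fin k, ∀ x : R,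
    s i * x ∈ Ideal.span (s '' {j | j < i}) → x ∈ Ideal.span (s '' {j | j < i})

/-- A permutable weak regular sequence of non-units. -/
def IsPermutableWeakRegularSeq {k : ℕ} (s : Fin k → R) : Prop :=
  (∀ i, ¬ IsUnit (s i)) ∧ ∀ σ : Equiv.Perm (Fin k), IsWeakRegularSeq (s ∘ σ)

/-- `M` has a free resolution `0 → F_p → ⋯ → F_0 → M → 0` by finitely generated
free `S`-modules. -/
def HasFiniteFreeResolutionOfLength (S : Type*) [CommRing S] (M : Type*) [AddCommGroup M]
    [Module S M] (p : ℕ) : Prop :=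
  ∃ (d : ℕ → ℕ) (g : ∀ i : ℕ, (Fin (d (i + 1)) → S) →ₗ[S] (Fin (d i) → S))
    (ε : (Fin (d 0) → S) →ₗ[S] M),
    (∀ i, p < i → d i = 0) ∧
    Function.Surjective ε ∧
    LinearMap.range (g 0) = LinearMap.ker ε ∧
    ∀ i, LinearMap.range (g (i + 1)) = LinearMap.ker (g i)

/-- `M` has an infinite free resolution `⋯ → F_p → F_p → F_p → F_{p-1} → ⋯ → F_0 → M → 0`
by finitely generated free `S`-modules, whose modules are constant from stage `p` on. -/
def HasEventuallyConstantFreeResolution (S : Type*) [CommRing S] (M : Type*) [AddCommGroup M]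
    [Module S M] (p : ℕ) : Prop :=
  ∃ (d : ℕ → ℕ) (g : ∀ i : ℕ, (Fin (d (i + 1)) → S) →ₗ[S] (Fin (d i) → S))
    (ε : (Fin (d 0) → S) →ₗ[S] M),
    (∀ i, p ≤ i → d i = d p) ∧
    Function.Surjective ε ∧
    LinearMap.range (g 0) = LinearMap.ker ε ∧
    ∀ i, LinearMap.range (g (i + 1)) = LinearMap.ker (g i)

end PaperGB

open PaperGB

section

universe u

/-- `M` has a resolution of length at most `k` by finitely generated free modules. -/
def HasFreeRes (A : Type u) [CommRing A] :
    ℕ → ∀ (M : Type u) [AddCommGroup M] [Module A M], Prop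
  | 0, M, _, _ => Module.Free A M ∧ Module.Finite A M
  | k + 1, M, _, _ => ∃ (F : Type u) (_ : AddCommGroup F) (_ : Module A F)
      (_ : Module.Free A F) (_ : Module.Finite A F) (f : F →ₗ[A] M),
      Function.Surjective f ∧ HasFreeRes A k (LinearMap.ker f)

namespace HasFreeRes

variable {A : Type u} [CommRing A]

theorem of_equiv {k : ℕ} {M N : Type u} [AddCommGroup M] [Module A M] [AddCommGroup N]
    [Module A N] (e : M ≃ₗ[A] N) (h : HasFreeRes A k M) : HasFreeRes A k N := by
  cases k with
  | zero =>
    obtain ⟨_, _⟩ := h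
    exact ⟨Module.Free.of_equiv e, Module.Finite.equiv e⟩
  | succ k =>
    obtain ⟨F, _, _, _, _, f, hf, hk⟩ := h
    refine ⟨F, _, _, ‹_›, ‹_›, e.toLinearMap ∘ₗ f, e.surjective.comp hf, ?_⟩
    rwa [LinearEquiv.ker_comp]

theorem of_exact {k : ℕ} {K F M : Type u} [AddCommGroup M] [Module A M] [AddCommGroup F]
    [Module A F] [AddCommGroup K] [Module A K] [Module.Free A F] [Module.Finite A F]
    {i : K →ₗ[A] F} {f : F →ₗ[A] M} (hi : Function.Injective i) (hif : Function.Exact i f)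
    (hf : Function.Surjective f) (h : HasFreeRes A k K) : HasFreeRes A (k + 1) M := by
  refine ⟨F, _, _, ‹_›, ‹_›, f, hf, h.of_equiv ?_⟩
  exact (LinearEquiv.ofInjective i hi).trans
    (LinearEquiv.ofEq _ _ (LinearMap.exact_iff.mp hif).symm)

theorem of_subsingleton (k : ℕ) (M : Type u) [AddCommGroup M] [Module A M] [Subsingleton M] :
    HasFreeRes A k M := by
  induction k generalizing M with
  | zero => exact ⟨inferInstance, inferInstance⟩
  | succ k ih => exact ⟨M, _, _, inferInstance, inferInstance, .id, fun x ↦ ⟨x, rfl⟩, ih _⟩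

theorem succ {k : ℕ} {M : Type u} [AddCommGroup M] [Module A M] (h : HasFreeRes A k M) :
    HasFreeRes A (k + 1) M := by
  induction k generalizing M with
  | zero =>
    obtain ⟨_, _⟩ := h
    refine ⟨M, _, _, ‹_›, ‹_›, .id, fun x ↦ ⟨x, rfl⟩, ?_⟩
    rw [LinearMap.ker_id]
    exact of_subsingleton _ _
  | succ k ih =>
    obtain ⟨F, _, _, _, _, f, hf, hk⟩ := h
    exact ⟨F, _, _, ‹_›, ‹_›, f, hf, ih hk⟩

theorem mono {k l : ℕ} (hkl : k ≤ l) {M : Type u} [AddCommGroup M] [Module A M]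
    (h : HasFreeRes A k M) : HasFreeRes A l M := by
  induction l, hkl using Nat.le_induction with
  | base => exact h
  | succ l _ ih => exact ih.succ

theorem extension {k : ℕ} {X Y Z : Type u} [AddCommGroup X] [Module A X] [AddCommGroup Y]
    [Module A Y] [AddCommGroup Z] [Module A Z] {i : X →ₗ[A] Y} {g : Y →ₗ[A] Z}
    (hi : Function.Injective i) (hig : Function.Exact i g) (hg : Function.Surjective g)
    (hX : HasFreeRes A k X) (hZ : HasFreeRes A k Z) : HasFreeRes A k Y := by
  induction k generalizing X Y Z with
  | zero =>
    obtain ⟨_, _⟩ := hX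
    obtain ⟨_, _⟩ := hZ
    obtain ⟨s, hs⟩ := Module.projective_lifting_property g .id hg
    let e := (hig.splitSurjectiveEquiv hi ⟨s, hs⟩).1
    exact ⟨Module.Free.of_equiv e.symm, Module.Finite.equiv e.symm⟩
  | succ k ih =>
    obtain ⟨F₁, _, _, _, _, f₁, hf₁, h₁⟩ := hX
    obtain ⟨F₃, _, _, _, _, f₃, hf₃, h₃⟩ := hZ
    obtain ⟨s, hs⟩ := Module.projective_lifting_property g f₃ hg
    have hs' (b : F₃) : g (s b) = f₃ b := LinearMap.congr_fun hs b
    have hgi (x : X) : g (i x) = 0 := hig.apply_apply_eq_zero x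
    let f : F₁ × F₃ →ₗ[A] Y := (i ∘ₗ f₁).coprod s
    have hfs : Function.Surjective f := by
      intro y
      obtain ⟨b, hb⟩ := hf₃ (g y)
      obtain ⟨x, hx⟩ := (hig (y - s b)).mp (by simp [hs', hb])
      obtain ⟨a, rfl⟩ := hf₁ x
      exact ⟨(a, b), by simp [f, hx]⟩
    refine ⟨F₁ × F₃, _, _, inferInstance, inferInstance, f, hfs, ?_⟩
    let j : LinearMap.ker f₁ →ₗ[A] LinearMap.ker f :=
      (LinearMap.inl A F₁ F₃).restrict fun a ha ↦ by
        simp only [LinearMap.mem_ker] at ha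
        simp [f, ha]
    let q : LinearMap.ker f →ₗ[A] LinearMap.ker f₃ :=
      (LinearMap.snd A F₁ F₃).restrict fun a ha ↦ by
        have := congrArg g (LinearMap.mem_ker.mp ha)
        simpa [f, hs', hgi] using this
    refine ih (i := j) (g := q) ?_ ?_ ?_ h₁ h₃
    · intro a b hab
      have := congrArg (fun z ↦ z.1.1) hab
      exact Subtype.ext this
    · rintro ⟨⟨a, b⟩, hab⟩
      constructor
      · intro h
        have hb : b = 0 := congrArg Subtype.val h
        subst hb
        have : f₁ a = 0 := hi (by simpa [f] using hab)
        exact ⟨⟨a, this⟩, rfl⟩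
      · rintro ⟨c, hc⟩
        rw [← hc]
        rfl
    · rintro ⟨b, hb⟩
      obtain ⟨x, hx⟩ := (hig (s b)).mp (by rw [hs']; exact hb)
      obtain ⟨a, rfl⟩ := hf₁ x
      exact ⟨⟨(-a, b), by simp [f, hx]⟩, rfl⟩

theorem quotient {k : ℕ} {X Y Z : Type u} [AddCommGroup X] [Module A X] [AddCommGroup Y]
    [Module A Y] [AddCommGroup Z] [Module A Z] {i : X →ₗ[A] Y} {g : Y →ₗ[A] Z}
    (hi : Function.Injective i) (hig : Function.Exact i g) (hg : Function.Surjective g)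
    (hX : HasFreeRes A k X) (hY : HasFreeRes A k Y) : HasFreeRes A (k + 1) Z := by
  obtain ⟨F, _, _, _, _, f, hf, h⟩ := hY.succ
  refine ⟨F, _, _, ‹_›, ‹_›, g ∘ₗ f, hg.comp hf, ?_⟩
  let e := LinearEquiv.ofInjective i hi
  have hgf (a : LinearMap.ker (g ∘ₗ f)) : f a ∈ LinearMap.range i := (hig _).mp a.2
  let j : LinearMap.ker f →ₗ[A] LinearMap.ker (g ∘ₗ f) :=
    Submodule.inclusion (LinearMap.ker_le_ker_comp f g)
  let q : LinearMap.ker (g ∘ₗ f) →ₗ[A] LinearMap.range i :=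
    (f ∘ₗ Submodule.subtype _).codRestrict _ hgf
  refine extension (i := j) (g := q) (Submodule.inclusion_injective _) ?_ ?_ h (hX.of_equiv e)
  · rintro ⟨a, ha⟩
    constructor
    · intro h
      exact ⟨⟨a, congrArg Subtype.val h⟩, rfl⟩
    · rintro ⟨c, hc⟩
      rw [← hc]
      exact Subtype.ext c.2
  · rintro ⟨_, x, rfl⟩
    obtain ⟨a, ha⟩ := hf (i x)
    exact ⟨⟨a, by simp [ha, hig.apply_apply_eq_zero]⟩, Subtype.ext ha⟩

/-- A projective module with a finite free resolution is stably free. -/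
theorem isStablyFree {k : ℕ} {P : Type u} [AddCommGroup P] [Module A P]
    [Module.Projective A P] (h : HasFreeRes A k P) : Module.IsStablyFree A P := by
  induction k generalizing P with
  | zero =>
    obtain ⟨_, _⟩ := h
    infer_instance
  | succ k ih =>
    obtain ⟨F, _, _, _, _, f, hf, hk⟩ := h
    obtain ⟨s, hs⟩ := Module.projective_lifting_property f (.id : P →ₗ[A] P) hf
    let e : F ≃ₗ[A] LinearMap.ker f × P :=
      ((LinearMap.exact_subtype_ker_map f).splitSurjectiveEquiv Subtype.val_injective ⟨s, hs⟩).1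
    have : Module.Projective A (LinearMap.ker f) :=
      .of_split (e.symm.toLinearMap ∘ₗ LinearMap.inl A (LinearMap.ker f) P)
        (LinearMap.fst A (LinearMap.ker f) P ∘ₗ e.toLinearMap) (by ext x; simp)
    have : Module.Finite A (LinearMap.ker f) :=
      .of_surjective (LinearMap.fst A (LinearMap.ker f) P ∘ₗ e.toLinearMap)
        (Prod.fst_surjective.comp e.surjective)
    have := ih hk
    obtain ⟨N, _, _, _, _, _⟩ := Module.IsStablyFree.exist_free_prod A (LinearMap.ker f)
    have : Module.Free A ((LinearMap.ker f × N) × P) :=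
      .of_equiv ((e.prodCongr (.refl A N)).trans
        ((LinearEquiv.prodAssoc A _ _ _).trans
          (((LinearEquiv.refl A _).prodCongr (LinearEquiv.prodComm A P N)).trans
            (LinearEquiv.prodAssoc A _ _ _).symm)))
    have : Module.Finite A (LinearMap.ker f × N) := inferInstance
    exact .of_free_prod' A P (LinearMap.ker f × N)

open TensorProduct in
theorem baseChange (B : Type u) [CommRing B] [Algebra A B] [Module.Flat A B] {k : ℕ}
    {M : Type u} [AddCommGroup M] [Module A M] (h : HasFreeRes A k M) :
    HasFreeRes B k (B ⊗[A] M) := by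
  induction k generalizing M with
  | zero =>
    obtain ⟨_, _⟩ := h
    exact ⟨inferInstance, inferInstance⟩
  | succ k ih =>
    obtain ⟨F, _, _, _, _, f, hf, hk⟩ := h
    exact of_exact (i := (LinearMap.ker f).subtype.baseChange B) (f := f.baseChange B)
      (Module.Flat.lTensor_preserves_injective_linearMap _ Subtype.val_injective)
      (lTensor_exact B (LinearMap.exact_subtype_ker_map f) hf)
      (LinearMap.lTensor_surjective B hf) (ih hk)

end HasFreeRes

open Polynomial in
theorem Polynomial.exists_C_pow_mul_mem {A : Type*} [CommRing A] {P Q : Ideal A[X]} {f : A[X]}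
    (hfP : f ∈ P) (hmin : ∀ g ∈ P, g ∉ Q → f.degree ≤ g.degree) {g : A[X]} (hg : g ∈ P) :
    ∃ k : ℕ, Polynomial.C f.leadingCoeff ^ k * g ∈ Ideal.span {f} ⊔ Q := by
  obtain ⟨n, hn⟩ : ∃ n : ℕ, g.degree < n := ⟨g.natDegree + 1, by
    exact_mod_cast degree_le_natDegree.trans_lt (by exact_mod_cast Nat.lt_succ_self _)⟩
  induction n generalizing g with
  | zero =>
    have : g = 0 := by simpa [Nat.WithBot.lt_zero_iff] using hn
    exact ⟨0, by simp [this]⟩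
  | succ n ih =>
    by_cases hgQ : g ∈ Q
    · exact ⟨0, by simpa using Ideal.mem_sup_right hgQ⟩
    have hfn : f.natDegree ≤ n := by
      have := (hmin g hg hgQ).trans_lt hn
      rw [← Nat.lt_succ_iff]
      by_cases hf : f = 0
      · simp [hf]
      · rw [degree_eq_natDegree hf] at this
        exact_mod_cast this
    set h : A[X] := Polynomial.C f.leadingCoeff * g -
      Polynomial.C (g.coeff n) * Polynomial.X ^ (n - f.natDegree) * f with hh
    have hdeg : h.degree < n := by
      rw [degree_lt_iff_coeff_zero] at hn ⊢
      intro m hm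
      rw [hh, coeff_sub, coeff_C_mul, mul_assoc, coeff_C_mul, coeff_X_pow_mul',
        if_pos (by lia)]
      rcases hm.eq_or_lt with rfl | hm
      · rw [Nat.sub_sub_self hfn, ← leadingCoeff]
        ring
      · rw [hn m hm, coeff_eq_zero_of_natDegree_lt (show f.natDegree < _ by lia)]
        ring
    obtain ⟨k, hk⟩ := ih (g := h) (P.sub_mem (P.mul_mem_left _ hg) (P.mul_mem_left _ hfP)) hdeg
    refine ⟨k + 1, ?_⟩
    have : Polynomial.C f.leadingCoeff ^ (k + 1) * g =
        Polynomial.C f.leadingCoeff ^ k * h +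
        Polynomial.C f.leadingCoeff ^ k *
          (Polynomial.C (g.coeff n) * Polynomial.X ^ (n - f.natDegree)) * f := by
      rw [hh]
      ring
    rw [this]
    exact Ideal.add_mem _ hk
      (Ideal.mem_sup_left (Ideal.mul_mem_left _ _ (Ideal.mem_span_singleton_self f)))

/-- Every finitely generated `A`-module has a finite resolution by finitely generated free
modules. -/
def AllHaveFreeRes (A : Type u) [CommRing A] : Prop :=
  ∀ (M : Type u) [AddCommGroup M] [Module A M] [Module.Finite A M], ∃ k, HasFreeRes A k M

open Polynomial in
theorem AllHaveFreeRes.polynomial {A : Type u} [CommRing A] [IsNoetherianRing A]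
    (hA : AllHaveFreeRes A) : AllHaveFreeRes A[X] := by
  suffices H : ∀ (I : Ideal A) (M : Type u) [AddCommGroup M] [Module A[X] M]
      [Module.Finite A[X] M], I ≤ (Module.annihilator A[X] M).comap Polynomial.C →
      ∃ k, HasFreeRes A[X] k M from fun M ↦ H ⊥ M bot_le
  intro I
  induction I using WellFoundedGT.induction with
  | ind I IH =>
  intro M _ _ hM hI
  induction hM using IsNoetherianRing.induction_on_isQuotientEquivQuotientPrime with
  | subsingleton N => exact ⟨0, .of_subsingleton _ _⟩
  | exact N₁ N₂ N₃ i g hi hg hig h₁ h₃ =>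
    obtain ⟨k₁, h₁⟩ := h₁ (hI.trans (Ideal.comap_mono (i.annihilator_le_of_injective hi)))
    obtain ⟨k₃, h₃⟩ := h₃ (hI.trans (Ideal.comap_mono (g.annihilator_le_of_surjective hg)))
    exact ⟨_, .extension hi hig hg (h₁.mono (le_max_left k₁ k₃)) (h₃.mono (le_max_right k₁ k₃))⟩
  | quotient N p e =>
  obtain ⟨P, hP⟩ := p
  dsimp only at e
  rw [e.annihilator_eq, Ideal.annihilator_quotient] at hI
  suffices H : ∃ k, HasFreeRes A[X] k (A[X] ⧸ P) from H.imp fun k hk ↦ hk.of_equiv e.symm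
  rcases hI.lt_or_eq with hlt | rfl
  · exact IH _ hlt _ (by rw [Ideal.annihilator_quotient])
  set I := P.comap Polynomial.C with hIdef
  have hIprime : I.IsPrime := inferInstance
  set Q : Ideal A[X] := I.map Polynomial.C with hQdef
  have hQ : Q.IsPrime := Ideal.isPrime_map_C_of_isPrime
  have hQP : Q ≤ P := Ideal.map_comap_le
  obtain ⟨k₀, hk₀⟩ : ∃ k, HasFreeRes A[X] k (A[X] ⧸ Q) := by
    obtain ⟨k, hk⟩ := hA (A ⧸ I)
    exact ⟨k, (hk.baseChange A[X]).of_equiv (I.qoutMapEquivTensorQout A[X]).symm⟩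
  by_cases hPQ : P ≤ Q
  · rw [le_antisymm hPQ hQP]
    exact ⟨k₀, hk₀⟩
  obtain ⟨f, ⟨hfP, hfQ⟩, hmin⟩ : ∃ f, (f ∈ P ∧ f ∉ Q) ∧ ∀ g ∈ P, g ∉ Q → f.degree ≤ g.degree := by
    obtain ⟨f, hf, hmin⟩ := WellFounded.has_min (InvImage.wf degree (wellFounded_lt))
      {f : A[X] | f ∈ P ∧ f ∉ Q} (SetLike.not_le_iff_exists.mp hPQ)
    exact ⟨f, hf, fun g hg hg' ↦ not_lt.mp (hmin g ⟨hg, hg'⟩)⟩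
  have hlc : f.leadingCoeff ∉ I := by
    intro hmem
    have hmon : monomial f.natDegree f.leadingCoeff ∈ Q := by
      rw [← Polynomial.C_mul_X_pow_eq_monomial]
      exact Q.mul_mem_right _ (Ideal.mem_map_of_mem Polynomial.C hmem)
    have hadd := eraseLead_add_monomial_natDegree_leadingCoeff f
    have h0 : f ≠ 0 := by rintro rfl; exact hfQ Q.zero_mem
    refine (degree_eraseLead_lt h0).not_ge (hmin _ ?_ fun h ↦ hfQ ?_)
    · exact (P.add_mem_iff_left (hQP hmon)).mp (by rwa [hadd])
    · exact hadd ▸ Q.add_mem h hmon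
  set Q' : Ideal A[X] := Ideal.span {f} ⊔ Q with hQ'def
  have hQ'P : Q' ≤ P := sup_le ((Ideal.span_singleton_le_iff_mem _).mpr hfP) hQP
  have hQQ' : Q ≤ Q' := le_sup_right
  have hk₁ : HasFreeRes A[X] (k₀ + 1) (A[X] ⧸ Q') := by
    refine .quotient (i := LinearMap.lsmul A[X] (A[X] ⧸ Q) f) (g := Submodule.factor hQQ') ?_ ?_
      (Submodule.factor_surjective _) hk₀ hk₀
    · rw [← LinearMap.ker_eq_bot, LinearMap.ker_eq_bot']
      intro x hx
      obtain ⟨x, rfl⟩ := Submodule.Quotient.mk_surjective _ x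
      simp only [LinearMap.lsmul_apply, ← Submodule.Quotient.mk_smul,
        Submodule.Quotient.mk_eq_zero, smul_eq_mul] at hx ⊢
      exact (hQ.mem_or_mem hx).resolve_left hfQ
    · intro x
      obtain ⟨x, rfl⟩ := Submodule.Quotient.mk_surjective _ x
      constructor
      · intro h
        have hx : x ∈ Q' := (Submodule.Quotient.mk_eq_zero _).mp h
        obtain ⟨a, ha, q, hq, rfl⟩ := Submodule.mem_sup.mp hx
        obtain ⟨b, rfl⟩ := Ideal.mem_span_singleton'.mp ha
        refine ⟨Submodule.Quotient.mk b, ?_⟩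
        rw [LinearMap.lsmul_apply, ← Submodule.Quotient.mk_smul, Submodule.Quotient.eq, smul_eq_mul]
        convert Q.neg_mem hq using 1
        ring
      · rintro ⟨y, hy⟩
        obtain ⟨y, rfl⟩ := Submodule.Quotient.mk_surjective _ y
        rw [← hy]
        refine (Submodule.Quotient.mk_eq_zero Q').mpr ?_
        exact Ideal.mem_sup_left (Ideal.mul_mem_right _ _ (Ideal.mem_span_singleton_self f))
  obtain ⟨K, hK⟩ : ∃ K : ℕ, ∀ g ∈ P, Polynomial.C f.leadingCoeff ^ K * g ∈ Q' := by
    obtain ⟨s, hs⟩ := (isNoetherianRing_iff_ideal_fg A[X]).mp inferInstance P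
    have hsP (g : s) : g.1 ∈ P := hs ▸ Ideal.subset_span g.2
    choose k hk using fun g : s ↦ exists_C_pow_mul_mem hfP hmin (hsP g)
    refine ⟨Finset.univ.sup k, fun g hg ↦ ?_⟩
    have : P ≤ Submodule.comap (LinearMap.lsmul A[X] A[X]
        (Polynomial.C f.leadingCoeff ^ Finset.univ.sup k)) Q' := by
      conv_lhs => rw [← hs]
      refine Submodule.span_le.mpr fun g hg ↦ ?_
      have hle : k ⟨g, hg⟩ ≤ Finset.univ.sup k := Finset.le_sup (Finset.mem_univ _)
      change Polynomial.C f.leadingCoeff ^ Finset.univ.sup k * g ∈ Q'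
      rw [← Nat.sub_add_cancel hle, pow_add, mul_assoc]
      exact Q'.mul_mem_left _ (hk ⟨g, hg⟩)
    exact this hg
  let q := Submodule.factor hQ'P
  have hq {x : A[X]} : q (Submodule.Quotient.mk x) = Submodule.Quotient.mk x := rfl
  have hmem (x : LinearMap.ker q) : ∃ y ∈ P, Submodule.Quotient.mk y = x.1 := by
    obtain ⟨⟨x⟩, hx⟩ := x
    exact ⟨x, (Submodule.Quotient.mk_eq_zero P).mp hx, rfl⟩
  obtain ⟨k₂, hk₂⟩ : ∃ k, HasFreeRes A[X] k (LinearMap.ker q) := by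
    refine IH ((Module.annihilator A[X] (LinearMap.ker q)).comap Polynomial.C) ?_ _ le_rfl
    refine lt_of_le_not_ge ?_ fun h ↦ hlc (hIprime.mem_of_pow_mem K (h ?_))
    · intro a ha
      rw [Ideal.mem_comap, Module.mem_annihilator]
      intro x
      obtain ⟨y, hy, hyx⟩ := hmem x
      refine Subtype.ext ?_
      rw [Submodule.coe_smul, ← hyx, ← Submodule.Quotient.mk_smul]
      exact (Submodule.Quotient.mk_eq_zero Q').mpr
        (hQQ' (Q.mul_mem_right _ (Ideal.mem_map_of_mem Polynomial.C ha)))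
    · rw [Ideal.mem_comap, Module.mem_annihilator]
      intro x
      obtain ⟨y, hy, hyx⟩ := hmem x
      refine Subtype.ext ?_
      rw [Submodule.coe_smul, ← hyx, ← Submodule.Quotient.mk_smul, map_pow]
      exact (Submodule.Quotient.mk_eq_zero Q').mpr (hK y hy)
  exact ⟨_, .quotient Subtype.val_injective (LinearMap.exact_subtype_ker_map q)
    (Submodule.factor_surjective _) (hk₂.mono (le_max_right (k₀ + 1) k₂))
    (hk₁.mono (le_max_left (k₀ + 1) k₂))⟩

open TensorProduct in
/-- If `A → B` is surjective, a `B`-module is the base change of its restriction to `A`. -/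
noncomputable def tensorEquivOfSurjective {A B M : Type*} [CommRing A] [CommRing B]
    [Algebra A B] (hsurj : Function.Surjective (algebraMap A B)) [AddCommGroup M] [Module A M]
    [Module B M] [IsScalarTower A B M] : B ⊗[A] M ≃ₗ[B] M :=
  have : TensorProduct.CompatibleSMul A B B M := ⟨fun b x m ↦ by
    obtain ⟨a, rfl⟩ := hsurj b
    rw [algebraMap_smul, algebraMap_smul, smul_tmul]⟩
  TensorProduct.lidOfCompatibleSMul A B M

theorem AllHaveFreeRes.of_ringEquiv {A B : Type u} [CommRing A] [CommRing B] (e : A ≃+* B)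
    (hA : AllHaveFreeRes A) : AllHaveFreeRes B := by
  intro M _ _ _
  let : Algebra A B := e.toRingHom.toAlgebra
  have hbij : Function.Bijective (algebraMap A B) := e.bijective
  let : Module A M := Module.compHom M (algebraMap A B)
  have : IsScalarTower A B M := ⟨fun a b m ↦ by
    rw [Algebra.smul_def, mul_smul]; rfl⟩
  have : Module.Finite A B := .of_surjective (Algebra.linearMap A B) hbij.2
  have : Module.Finite A M := .trans B M
  have : Module.Free A B := .of_equiv (LinearEquiv.ofBijective (Algebra.linearMap A B) hbij)
  obtain ⟨k, hk⟩ := hA M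
  exact ⟨k, (hk.baseChange B).of_equiv (tensorEquivOfSurjective hbij.2)⟩

theorem AllHaveFreeRes.of_isPrincipalIdealRing (A : Type u) [CommRing A] [IsDomain A]
    [IsPrincipalIdealRing A] : AllHaveFreeRes A := by
  intro M _ _ _
  obtain ⟨n, f, hf⟩ := Module.Finite.exists_fin' A M
  exact ⟨1, .of_exact (F := Fin n → A) Subtype.val_injective (LinearMap.exact_subtype_ker_map f) hf
    ⟨inferInstance, inferInstance⟩⟩

theorem AllHaveFreeRes.mvPolynomial (A : Type u) [CommRing A] [IsDomain A]
    [IsPrincipalIdealRing A] (n : ℕ) : AllHaveFreeRes (MvPolynomial (Fin n) A) := by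
  induction n with
  | zero =>
    exact (AllHaveFreeRes.of_isPrincipalIdealRing A).of_ringEquiv
      (MvPolynomial.isEmptyAlgEquiv A (Fin 0)).symm.toRingEquiv
  | succ n ih =>
    exact ih.polynomial.of_ringEquiv (MvPolynomial.finSuccEquiv A n).symm.toRingEquiv

open CategoryTheory

/-- Every `A`-module has projective dimension less than `n`. -/
def GlobalDimLT (A : Type u) [CommRing A] (n : ℕ) : Prop :=
  ∀ (M : Type u) [AddCommGroup M] [Module A M], HasProjectiveDimensionLT (ModuleCat.of A M) n

section ShortExact

variable {A : Type u} [CommRing A] {X Y Z : Type u} [AddCommGroup X] [Module A X]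
  [AddCommGroup Y] [Module A Y] [AddCommGroup Z] [Module A Z] {i : X →ₗ[A] Y} {g : Y →ₗ[A] Z}

theorem shortExact_of_linearMap (hi : Function.Injective i) (hig : Function.Exact i g)
    (hg : Function.Surjective g) :
    (ModuleCat.shortComplexOfCompEqZero i g hig.linearMap_comp_eq_zero).ShortExact :=
  ModuleCat.shortComplex_shortExact _ hig hi hg

theorem hasProjectiveDimensionLT_one (A : Type u) [CommRing A] (P : Type u) [AddCommGroup P]
    [Module A P] [Module.Projective A P] : HasProjectiveDimensionLT (ModuleCat.of A P) 1 :=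
  projective_iff_hasProjectiveDimensionLT_one.mp ((IsProjective.iff_projective P).mp ‹_›)

theorem Module.projective_of_hasProjectiveDimensionLT_one {A : Type u} [CommRing A] {P : Type u}
    [AddCommGroup P] [Module A P] (h : HasProjectiveDimensionLT (ModuleCat.of A P) 1) :
    Module.Projective A P :=
  (IsProjective.iff_projective P).mpr (projective_iff_hasProjectiveDimensionLT_one.mpr h)

end ShortExact

theorem Module.Injective.quotient_of_isPrincipalIdealRing {A : Type u} [CommRing A] [IsDomain A]
    [IsPrincipalIdealRing A] {J : Type u} [AddCommGroup J] [Module A J] [Module.Injective A J]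
    (N : Submodule A J) : Module.Injective A (J ⧸ N) := by
  have hdiv (a : A) (ha : a ≠ 0) (x : J ⧸ N) : ∃ y : J ⧸ N, a • y = x := by
    obtain ⟨x, rfl⟩ := N.mkQ_surjective x
    obtain ⟨h, hh⟩ := Module.Injective.out (LinearMap.lsmul A A a)
      (mul_right_injective₀ ha) (LinearMap.toSpanSingleton A J x)
    refine ⟨N.mkQ (h 1), ?_⟩
    have := hh 1
    rw [← map_smul, ← map_smul]
    simpa using congrArg N.mkQ this
  refine Module.Baer.injective fun I g ↦ ?_
  rcases IsPrincipalIdealRing.principal I with ⟨m, rfl⟩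
  obtain rfl | h0 := eq_or_ne m 0
  · refine ⟨0, fun n hn ↦ ?_⟩
    rw [Submodule.span_zero_singleton] at hn
    subst hn
    exact (map_zero g).symm
  · set gₘ := g ⟨m, Submodule.subset_span (Set.mem_singleton _)⟩ with gm_eq
    obtain ⟨y, hy⟩ := hdiv m h0 gₘ
    refine ⟨LinearMap.toSpanSingleton A _ y, fun n hn ↦ ?_⟩
    rcases Submodule.mem_span_singleton.mp hn with ⟨n, rfl⟩
    rw [map_smul, LinearMap.toSpanSingleton_apply, hy, gm_eq, ← map_smul]
    congr

theorem GlobalDimLT.of_isPrincipalIdealRing (A : Type u) [CommRing A] [IsDomain A]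
    [IsPrincipalIdealRing A] : GlobalDimLT A 2 := by
  have key (N : ModuleCat.{u} A) : HasInjectiveDimensionLT N 2 := by
    obtain ⟨⟨J, hJ, f, hf⟩⟩ := EnoughInjectives.presentation N
    have : Module.Injective A J := Module.injective_module_of_injective_object A J
    have := Module.Injective.quotient_of_isPrincipalIdealRing (LinearMap.range f.hom)
    have := Module.injective_object_of_injective_module A (J ⧸ LinearMap.range f.hom)
    have hS := shortExact_of_linearMap ((ModuleCat.mono_iff_injective f).mp hf)
      (LinearMap.exact_map_mkQ_range f.hom) (Submodule.mkQ_surjective _)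
    exact hS.hasInjectiveDimensionLT_X₁ 1 inferInstance
      (inferInstanceAs (HasInjectiveDimensionLT J 2))
  intro M _ _
  exact .mk fun i hi Y e ↦ have := key Y; e.eq_zero_of_hasInjectiveDimensionLT 2 hi

theorem GlobalDimLT.of_ringEquiv {A B : Type u} [CommRing A] [CommRing B] (e : A ≃+* B) {n : ℕ}
    (hA : GlobalDimLT A (n + 1)) : GlobalDimLT B (n + 1) := by
  intro M _ _
  let : Module A M := Module.compHom M e.toRingHom
  have := hA M
  let := RingHomInvPair.of_ringEquiv e
  let := RingHomInvPair.of_ringEquiv e.symm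
  let e' : ModuleCat.of A M ≃ₛₗ[RingHomClass.toRingHom e] ModuleCat.of B M :=
    { AddEquiv.refl M with map_smul' := fun a m ↦ rfl }
  exact ModuleCat.hasProjectiveDimensionLE_of_semiLinearEquiv e e' n

open TensorProduct in
theorem hasProjectiveDimensionLT_baseChange {A B : Type u} [CommRing A] [CommRing B] [Algebra A B]
    [Module.Flat A B] {n : ℕ} {M : Type u} [AddCommGroup M] [Module A M]
    (h : HasProjectiveDimensionLT (ModuleCat.of A M) (n + 1)) :
    HasProjectiveDimensionLT (ModuleCat.of B (B ⊗[A] M)) (n + 1) := by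
  induction n generalizing M with
  | zero =>
    have := Module.projective_of_hasProjectiveDimensionLT_one h
    exact hasProjectiveDimensionLT_one B _
  | succ n ih =>
    obtain ⟨F, _, _, _, f, hf⟩ : ∃ (F : Type u) (_ : AddCommGroup F) (_ : Module A F)
        (_ : Module.Free A F) (f : F →ₗ[A] M), Function.Surjective f :=
      ⟨M →₀ A, inferInstance, inferInstance, inferInstance, Finsupp.linearCombination A id,
        Finsupp.linearCombination_id_surjective A M⟩
    have hS := LinearMap.shortExact_shortComplexKer hf
    have hS' := shortExact_of_linearMap (i := (LinearMap.ker f).subtype.baseChange B)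
      (g := f.baseChange B)
      (Module.Flat.lTensor_preserves_injective_linearMap _ Subtype.val_injective)
      (lTensor_exact B (LinearMap.exact_subtype_ker_map f) hf) (LinearMap.lTensor_surjective B hf)
    have h1 := hasProjectiveDimensionLT_one A F
    have h1' := hasProjectiveDimensionLT_one B (B ⊗[A] F)
    have hK := hS.hasProjectiveDimensionLT_X₁ (n + 1)
      (hasProjectiveDimensionLT_of_ge _ 1 _ (by lia)) h
    exact hS'.hasProjectiveDimensionLT_X₃ (n + 1) (ih hK)
      (hasProjectiveDimensionLT_of_ge _ 1 _ (by lia))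

section Koszul

open TensorProduct

variable {A M : Type*} [CommRing A] [AddCommGroup M] [Module A M]

/-- The `n`-th coefficient of an element of `A[X] ⊗ M`. -/
noncomputable def Polynomial.tensorCoeff (n : ℕ) : Polynomial A ⊗[A] M →ₗ[A] M :=
  TensorProduct.lid A M ∘ₗ (Polynomial.lcoeff A n).rTensor M

@[simp]
theorem Polynomial.tensorCoeff_tmul (n : ℕ) (p : Polynomial A) (m : M) :
    Polynomial.tensorCoeff n (p ⊗ₜ[A] m) = p.coeff n • m := by
  simp [Polynomial.tensorCoeff]

theorem Polynomial.exists_eq_sum_tensorCoeff (t : Polynomial A ⊗[A] M) :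
    ∃ B, ∀ N ≥ B, Polynomial.tensorCoeff N t = 0 ∧
      t = ∑ n ∈ Finset.range N, (Polynomial.X ^ n : Polynomial A) ⊗ₜ[A]
        Polynomial.tensorCoeff n t := by
  induction t with
  | zero => exact ⟨0, by simp⟩
  | add a b ha hb =>
    obtain ⟨B, hB⟩ := ha
    obtain ⟨C, hC⟩ := hb
    refine ⟨max B C, fun N hN ↦ ?_⟩
    obtain ⟨h1, h2⟩ := hB N (le_of_max_le_left hN)
    obtain ⟨h3, h4⟩ := hC N (le_of_max_le_right hN)
    refine ⟨by rw [map_add, h1, h3, add_zero], ?_⟩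
    simp only [map_add, TensorProduct.tmul_add, Finset.sum_add_distrib, ← h2, ← h4]
  | tmul p m =>
    refine ⟨p.natDegree + 1, fun N hN ↦ ⟨?_, ?_⟩⟩
    · rw [tensorCoeff_tmul, p.coeff_eq_zero_of_natDegree_lt (by lia), zero_smul]
    · conv_lhs => rw [p.as_sum_range' N (by lia), TensorProduct.sum_tmul]
      refine Finset.sum_congr rfl fun n _ ↦ ?_
      rw [tensorCoeff_tmul, ← TensorProduct.smul_tmul, Polynomial.smul_X_eq_monomial]

end Koszul

open Polynomial TensorProduct in
theorem GlobalDimLT.polynomial {A : Type u} [CommRing A] {n : ℕ} (hA : GlobalDimLT A (n + 1)) :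
    GlobalDimLT A[X] (n + 2) := by
  intro M _ _
  let : Module A M := Module.compHom M (algebraMap A A[X])
  have : IsScalarTower A A[X] M := ⟨fun a b m ↦ by rw [Algebra.smul_def, mul_smul]; rfl⟩
  let xM : M →ₗ[A] M := (LinearMap.lsmul A[X] M Polynomial.X).restrictScalars A
  let φ : A[X] ⊗[A] M →ₗ[A[X]] A[X] ⊗[A] M :=
    LinearMap.lsmul A[X] (A[X] ⊗[A] M) Polynomial.X - xM.baseChange A[X]
  let ε : A[X] ⊗[A] M →ₗ[A[X]] M := LinearMap.liftBaseChange A[X] LinearMap.id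
  have hφ (p : A[X]) (m : M) : φ (p ⊗ₜ m) =
      (Polynomial.X * p) ⊗ₜ m - p ⊗ₜ ((Polynomial.X : A[X]) • m) := by
    simp [φ, xM, TensorProduct.smul_tmul']
  have hε (p : A[X]) (m : M) : ε (p ⊗ₜ m) = p • m := rfl
  have hsurj : Function.Surjective ε := fun m ↦ ⟨1 ⊗ₜ m, one_smul _ m⟩
  have hpow (i : ℕ) (m : M) :
      (Polynomial.X ^ i : A[X]) ⊗ₜ[A] m - 1 ⊗ₜ ((Polynomial.X ^ i : A[X]) • m) ∈
        LinearMap.range φ := by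
    induction i generalizing m with
    | zero => simp
    | succ i ih =>
      have h := add_mem (ih ((Polynomial.X : A[X]) • m))
        (LinearMap.mem_range_self φ ((Polynomial.X ^ i : A[X]) ⊗ₜ[A] m))
      rw [hφ, ← mul_smul, ← pow_succ, ← pow_succ'] at h
      convert h using 1
      abel
  have hmod (t : A[X] ⊗[A] M) : t - 1 ⊗ₜ ε t ∈ LinearMap.range φ := by
    obtain ⟨B, hB⟩ := Polynomial.exists_eq_sum_tensorCoeff t
    rw [(hB B le_rfl).2, map_sum, TensorProduct.tmul_sum, ← Finset.sum_sub_distrib]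
    exact sum_mem fun i _ ↦ by rw [hε]; exact hpow i _
  have hexact : Function.Exact φ ε := by
    intro t
    constructor
    · intro ht
      simpa [ht] using hmod t
    · rintro ⟨s, rfl⟩
      induction s with
      | zero => simp
      | add a b ha hb => rw [map_add, map_add, ha, hb, add_zero]
      | tmul p m => rw [hφ, map_sub, hε, hε, mul_smul, smul_comm, sub_self]
  have hcoeff (i : ℕ) (t : A[X] ⊗[A] M) : tensorCoeff (i + 1) (φ t) =
      tensorCoeff i t - (Polynomial.X : A[X]) • tensorCoeff (i + 1) t := by
    induction t with
    | zero => simp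
    | add a b ha hb => rw [map_add, map_add, ha, hb, map_add, map_add, smul_add]; abel
    | tmul p m =>
      rw [hφ, map_sub, tensorCoeff_tmul, tensorCoeff_tmul, tensorCoeff_tmul, tensorCoeff_tmul,
        Polynomial.coeff_X_mul, smul_comm]
  have hinj : Function.Injective φ := by
    refine (injective_iff_map_eq_zero φ).mpr fun t ht ↦ ?_
    obtain ⟨B, hB⟩ := Polynomial.exists_eq_sum_tensorCoeff t
    have hz (i : ℕ) (hi : i ≤ B) : tensorCoeff i t = 0 := by
      induction hi using Nat.decreasingInduction with
      | self => exact (hB B le_rfl).1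
      | of_succ i _ ih => simpa [ht, ih] using (hcoeff i t).symm
    rw [(hB B le_rfl).2]
    exact Finset.sum_eq_zero fun i hi ↦ by
      rw [hz i (Finset.mem_range.mp hi).le, TensorProduct.tmul_zero]
  have hT := hasProjectiveDimensionLT_baseChange (B := A[X]) (hA M)
  exact (shortExact_of_linearMap hinj hexact hsurj).hasProjectiveDimensionLT_X₃ (n + 1) hT
    (hasProjectiveDimensionLT_of_ge _ (n + 1) _ (by lia))

theorem GlobalDimLT.mvPolynomial (A : Type u) [CommRing A] [IsDomain A]
    [IsPrincipalIdealRing A] (n : ℕ) : GlobalDimLT (MvPolynomial (Fin n) A) (n + 2) := by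
  induction n with
  | zero =>
    exact (GlobalDimLT.of_isPrincipalIdealRing A).of_ringEquiv
      (MvPolynomial.isEmptyAlgEquiv A (Fin 0)).symm.toRingEquiv
  | succ n ih =>
    exact ih.polynomial.of_ringEquiv (MvPolynomial.finSuccEquiv A n).symm.toRingEquiv

section SurjectiveQuotient

variable {A S : Type u} [CommRing A] [CommRing S] [Algebra A S]

theorem exists_linearMap_comp_algebraMap {a b : ℕ} (u : (Fin a → A) →ₗ[A] (Fin b → A)) :
    ∃ v : (Fin a → S) →ₗ[S] (Fin b → S),
      ∀ x, v (algebraMap A S ∘ x) = algebraMap A S ∘ u x := by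
  refine ⟨((LinearMap.toMatrix' u).map (algebraMap A S)).mulVecLin, fun x ↦ ?_⟩
  ext i
  rw [Matrix.mulVecLin_apply, ← RingHom.map_mulVec, LinearMap.toMatrix'_mulVec]
  rfl

theorem exists_linearMap_algebraMap_comp {a : ℕ} {M : Type*} [AddCommGroup M] [Module A M]
    [Module S M] [IsScalarTower A S M] (u : (Fin a → A) →ₗ[A] M) :
    ∃ v : (Fin a → S) →ₗ[S] M, ∀ x, v (algebraMap A S ∘ x) = u x := by
  refine ⟨Fintype.linearCombination S fun i ↦ u (Pi.single i 1), fun x ↦ ?_⟩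
  conv_rhs => rw [pi_eq_sum_univ' x, map_sum]
  simp [Fintype.linearCombination_apply, map_smul]

theorem exists_matrixFactorization [Nontrivial A] {t : A} (ht : t ∈ nonZeroDivisors A) {a b : ℕ}
    {g : (Fin a → A) →ₗ[A] (Fin b → A)} (hg : Function.Injective g)
    (htg : ∀ x, t • x ∈ LinearMap.range g) :
    ∃ (_ : a = b) (h : (Fin b → A) →ₗ[A] (Fin a → A)),
      (∀ x, g (h x) = t • x) ∧ ∀ x, h (g x) = t • x := by
  let h : (Fin b → A) →ₗ[A] (Fin a → A) := (LinearEquiv.ofInjective g hg).symm ∘ₗ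
    (t • LinearMap.id : (Fin b → A) →ₗ[A] (Fin b → A)).codRestrict (LinearMap.range g) htg
  have hgh (x) : g (h x) = t • x := by
    have := (LinearEquiv.ofInjective g hg).apply_symm_apply ⟨t • x, htg x⟩
    exact congrArg Subtype.val this
  have hinj : Function.Injective h := by
    refine (injective_iff_map_eq_zero h).mpr fun x hx ↦ ?_
    have := hgh x
    rw [hx, map_zero] at this
    ext i
    exact (mul_left_mem_nonZeroDivisors_eq_zero_iff ht).mp (congrFun this i).symm
  exact ⟨le_antisymm (le_of_fin_injective A g hg) (le_of_fin_injective A h hinj), h, hgh,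
    fun x ↦ hg (by rw [hgh, map_smul])⟩

theorem PaperGB.HasEventuallyConstantFreeResolution.succ {M : Type*} [AddCommGroup M] [Module S M]
    {m k : ℕ} (f : (Fin m → S) →ₗ[S] M) (hf : Function.Surjective f)
    (h : HasEventuallyConstantFreeResolution S (LinearMap.ker f) k) :
    HasEventuallyConstantFreeResolution S M (k + 1) := by
  obtain ⟨d, g, ε, hd, hε, h0, hg⟩ := h
  refine ⟨fun i ↦ Nat.casesOn i m d, fun i ↦ Nat.casesOn i ((LinearMap.ker f).subtype ∘ₗ ε) g,
    f, ?_, hf, ?_, ?_⟩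
  · rintro (_ | i) hi
    · lia
    · exact hd i (by lia)
  · change LinearMap.range ((LinearMap.ker f).subtype ∘ₗ ε) = LinearMap.ker f
    rw [LinearMap.range_comp_of_range_eq_top _ (LinearMap.range_eq_top.mpr hε),
      Submodule.range_subtype]
  · rintro (_ | i)
    · change LinearMap.range (g 0) = LinearMap.ker ((LinearMap.ker f).subtype ∘ₗ ε)
      rw [LinearMap.ker_comp_of_ker_eq_bot _ (Submodule.ker_subtype _), h0]
    · exact hg i

theorem PaperGB.HasEventuallyConstantFreeResolution.of_linearEquiv {M N : Type*} [AddCommGroup M]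
    [Module S M] [AddCommGroup N] [Module S N] {k : ℕ} (e : M ≃ₗ[S] N)
    (h : HasEventuallyConstantFreeResolution S M k) :
    HasEventuallyConstantFreeResolution S N k := by
  obtain ⟨d, g, ε, hd, hε, h0, hg⟩ := h
  refine ⟨d, g, e.toLinearMap ∘ₗ ε, hd, e.surjective.comp hε, ?_, hg⟩
  rw [h0, LinearEquiv.ker_comp]

theorem algebraMap_comp_eq_zero_iff {t : A}
    (hker : RingHom.ker (algebraMap A S) = Ideal.span {t}) {ι : Type*} {x : ι → A} :
    algebraMap A S ∘ x = 0 ↔ ∃ y : ι → A, x = t • y := by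
  have (i : ι) : algebraMap A S (x i) = 0 ↔ t ∣ x i := by
    rw [← RingHom.mem_ker, hker, Ideal.mem_span_singleton]
  simp only [funext_iff, Function.comp_apply, Pi.zero_apply, this, dvd_def, Classical.skolem,
    Pi.smul_apply, smul_eq_mul]

theorem hasEventuallyConstantFreeResolution_of_injective [Nontrivial A] {t : A}
    (hsurj : Function.Surjective (algebraMap A S))
    (hker : RingHom.ker (algebraMap A S) = Ideal.span {t})
    (ht : t ∈ nonZeroDivisors A) {M : Type*}
    [AddCommGroup M] [Module A M] [Module S M] [IsScalarTower A S M] {a b : ℕ}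
    {g : (Fin a → A) →ₗ[A] (Fin b → A)} {ε : (Fin b → A) →ₗ[A] M} (hg : Function.Injective g)
    (hgε : LinearMap.range g = LinearMap.ker ε) (hε : Function.Surjective ε) :
    HasEventuallyConstantFreeResolution S M 0 := by
  have htS : algebraMap A S t = 0 := by
    rw [← RingHom.mem_ker, hker]
    exact Ideal.mem_span_singleton_self t
  have hreg {c : ℕ} (x y : Fin c → A) (h : t • x = t • y) : x = y := by
    ext i
    exact (mul_cancel_left_mem_nonZeroDivisors ht).mp (congrFun h i)
  obtain ⟨rfl, h, hgh, hhg⟩ := exists_matrixFactorization ht hg fun x ↦ by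
    rw [hgε, LinearMap.mem_ker, map_smul, ← algebraMap_smul S, htS, zero_smul]
  have hπ (y : Fin a → S) : ∃ x : Fin a → A, algebraMap A S ∘ x = y := hsurj.comp_left y
  have key {u v : (Fin a → A) →ₗ[A] (Fin a → A)} {u' v' : (Fin a → S) →ₗ[S] (Fin a → S)}
      (hu : ∀ x, u' (algebraMap A S ∘ x) = algebraMap A S ∘ u x)
      (hv : ∀ x, v' (algebraMap A S ∘ x) = algebraMap A S ∘ v x)
      (huv : ∀ x, u (v x) = t • x) (hvu : ∀ x, v (u x) = t • x) :
      LinearMap.range u' = LinearMap.ker v' := by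
    ext y
    obtain ⟨y, rfl⟩ := hπ y
    rw [LinearMap.mem_ker, hv, algebraMap_comp_eq_zero_iff hker, LinearMap.mem_range]
    constructor
    · rintro ⟨x, hx⟩
      obtain ⟨x, rfl⟩ := hπ x
      rw [← algebraMap_comp_eq_zero_iff hker, ← hv, ← hx, hu, hv, algebraMap_comp_eq_zero_iff hker]
      exact ⟨x, hvu x⟩
    · rintro ⟨z, hz⟩
      refine ⟨algebraMap A S ∘ z, ?_⟩
      rw [hu]
      congr 1
      refine hreg _ _ ?_
      rw [← huv y, hz, map_smul]
  obtain ⟨g', hg'⟩ := exists_linearMap_comp_algebraMap (S := S) g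
  obtain ⟨h', hh'⟩ := exists_linearMap_comp_algebraMap (S := S) h
  obtain ⟨ε', hε'⟩ := exists_linearMap_algebraMap_comp (S := S) ε
  refine ⟨fun _ ↦ a, fun i ↦ if Even i then g' else h', ε', fun _ _ ↦ rfl, fun m ↦ ?_, ?_,
    fun i ↦ ?_⟩
  · obtain ⟨x, rfl⟩ := hε m
    exact ⟨_, hε' x⟩
  · ext y
    obtain ⟨y, rfl⟩ := hπ y
    rw [LinearMap.mem_ker, hε', ← LinearMap.mem_ker, ← hgε]
    constructor
    · rintro ⟨x, hx⟩
      obtain ⟨x, rfl⟩ := hπ x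
      have hx : algebraMap A S ∘ g x = algebraMap A S ∘ y := (hg' x).symm.trans hx
      rw [hgε, LinearMap.mem_ker, ← hε', ← hx, hε', ← LinearMap.mem_ker, ← hgε]
      exact LinearMap.mem_range_self g x
    · rintro ⟨x, rfl⟩
      exact ⟨_, hg' x⟩
  · beta_reduce
    by_cases hi : Even i
    · rw [if_pos hi, if_neg (by rwa [Nat.even_add_one, not_not])]
      exact key hh' hg' hhg hgh
    · rw [if_neg hi, if_pos (by rwa [Nat.even_add_one])]
      exact key hg' hh' hgh hhg

theorem hasProjectiveDimensionLT_two_pi {t : A}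
    (hsurj : Function.Surjective (algebraMap A S))
    (hker : RingHom.ker (algebraMap A S) = Ideal.span {t}) (ht : t ∈ nonZeroDivisors A) (m : ℕ) :
    HasProjectiveDimensionLT (ModuleCat.of A (Fin m → S)) 2 := by
  let i : (Fin m → A) →ₗ[A] (Fin m → A) := LinearMap.lsmul A _ t
  let g : (Fin m → A) →ₗ[A] (Fin m → S) := (Algebra.linearMap A S).compLeft (Fin m)
  have hi : Function.Injective i := fun x y h ↦ by
    ext j
    exact (mul_cancel_left_mem_nonZeroDivisors ht).mp (congrFun h j)
  have hig : Function.Exact i g := fun x ↦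
    (algebraMap_comp_eq_zero_iff hker).trans (exists_congr fun y ↦ eq_comm)
  have h := hasProjectiveDimensionLT_one A (Fin m → A)
  exact (shortExact_of_linearMap hi hig hsurj.comp_left).hasProjectiveDimensionLT_X₃ 1 h
    (hasProjectiveDimensionLT_of_ge _ 1 _ (by lia))

theorem hasEventuallyConstantFreeResolution_of_hasProjectiveDimensionLT [Nontrivial A]
    [IsNoetherianRing A] (hA : AllHaveFreeRes A) {t : A}
    (hsurj : Function.Surjective (algebraMap A S))
    (hker : RingHom.ker (algebraMap A S) = Ideal.span {t}) (ht : t ∈ nonZeroDivisors A)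
    (k : ℕ) (M : Type u) [AddCommGroup M] [Module A M] [Module S M] [IsScalarTower A S M]
    [Module.Finite S M] (hM : HasProjectiveDimensionLT (ModuleCat.of A M) (k + 2)) :
    HasEventuallyConstantFreeResolution S M k := by
  induction k generalizing M with
  | zero =>
    have : Module.Finite A S := .of_surjective (Algebra.linearMap A S) hsurj
    have : Module.Finite A M := .trans S M
    obtain ⟨b, ε, hε⟩ := Module.Finite.exists_fin' A M
    have hP := (LinearMap.shortExact_shortComplexKer hε).hasProjectiveDimensionLT_X₁ 1
      (hasProjectiveDimensionLT_one A (Fin b → A)) hM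
    have : Module.Projective A (LinearMap.ker ε) :=
      Module.projective_of_hasProjectiveDimensionLT_one hP
    obtain ⟨k, hk⟩ := hA (LinearMap.ker ε)
    have := hk.isStablyFree
    obtain ⟨N, _, _, _, _, _⟩ := this
    let e₁ := (Module.finBasis A (LinearMap.ker ε × N)).equivFun
    let e₂ := (Module.finBasis A ((Fin b → A) × N)).equivFun
    refine hasEventuallyConstantFreeResolution_of_injective hsurj hker ht
      (g := e₂.toLinearMap ∘ₗ (LinearMap.ker ε).subtype.prodMap LinearMap.id ∘ₗ e₁.symm.toLinearMap)
      (ε := ε ∘ₗ LinearMap.fst A _ N ∘ₗ e₂.symm.toLinearMap) ?_ ?_ ?_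
    · exact e₂.injective.comp
        ((Subtype.val_injective.prodMap Function.injective_id).comp e₁.symm.injective)
    · ext y
      obtain ⟨⟨y, z⟩, rfl⟩ := e₂.surjective y
      constructor
      · rintro ⟨x, hx⟩
        have := congrArg Prod.fst (e₂.injective hx)
        simp [← this]
      · intro hy
        have hy : y ∈ LinearMap.ker ε := by simpa using hy
        exact ⟨e₁ (⟨y, hy⟩, z), by simp⟩
    · exact hε.comp (Prod.fst_surjective.comp e₂.symm.surjective)
  | succ k ih =>
    obtain ⟨m, f, hf⟩ := Module.Finite.exists_fin' S M
    have : IsNoetherianRing S := isNoetherianRing_of_surjective A S (algebraMap A S) hsurj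
    refine .succ f hf (ih _ ?_)
    have hS := shortExact_of_linearMap (i := (LinearMap.ker f).subtype.restrictScalars A)
      (g := f.restrictScalars A) Subtype.val_injective (LinearMap.exact_subtype_ker_map f) hf
    have := hasProjectiveDimensionLT_two_pi hsurj hker ht m
    exact hS.hasProjectiveDimensionLT_X₁ (k + 2) (hasProjectiveDimensionLT_of_ge _ 2 _ (by lia)) hM

end SurjectiveQuotient

end

/-- Hilbert's syzygy theorem for a quotient of a PID: every finitely
generated module over `(R/NR)[x_1,…,x_n]` has an infinite free resolution by finitely
generated free modules which is constant from stage `p ≤ n+1` on. -/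
theorem hilbert_syzygy_quotient_PID
    {n : ℕ} {R : Type*} [CommRing R] [IsDomain R] [IsPrincipalIdealRing R]
    (N : R) (hN0 : N ≠ 0) (hNu : ¬ IsUnit N)
    (M : Type*) [AddCommGroup M]
    [Module (MvPolynomial (Fin n) (R ⧸ Ideal.span {N})) M]
    [Module.Finite (MvPolynomial (Fin n) (R ⧸ Ideal.span {N})) M] :
    ∃ p ≤ n + 1, HasEventuallyConstantFreeResolution
      (MvPolynomial (Fin n) (R ⧸ Ideal.span {N})) M p := by
  let A := MvPolynomial (Fin n) R
  let S := MvPolynomial (Fin n) (R ⧸ Ideal.span {N})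
  let φ : A →+* S := MvPolynomial.map (Ideal.Quotient.mk (Ideal.span {N}))
  let : Algebra A S := φ.toAlgebra
  have hsurj : Function.Surjective (algebraMap A S) :=
    MvPolynomial.map_surjective _ Ideal.Quotient.mk_surjective
  have hker : RingHom.ker (algebraMap A S) = Ideal.span {MvPolynomial.C N} := by
    change RingHom.ker φ = _
    rw [MvPolynomial.ker_map, Ideal.mk_ker, Ideal.map_span, Set.image_singleton]
  have ht : (MvPolynomial.C N : A) ∈ nonZeroDivisors A :=
    mem_nonZeroDivisors_of_ne_zero (by simpa [A] using hN0)
  obtain ⟨m, f, hf⟩ := Module.Finite.exists_fin' S M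
  let : Module A ((Fin m → S) ⧸ LinearMap.ker f) := Module.compHom _ (algebraMap A S)
  have : IsScalarTower A S ((Fin m → S) ⧸ LinearMap.ker f) :=
    ⟨fun a b x ↦ by rw [Algebra.smul_def, mul_smul]; rfl⟩
  exact ⟨n, n.le_succ, .of_linearEquiv (f.quotKerEquivOfSurjective hf)
    (hasEventuallyConstantFreeResolution_of_hasProjectiveDimensionLT (.mvPolynomial R n) hsurj hker
      ht n _ (GlobalDimLT.mvPolynomial R n _))⟩
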